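/- Let μ be a uniformly distributed measure on ℝ^d with support Σ, and let u ∈ Σ. For every x ∈ ℝ^d and s > 0 the function z ↦ e^{−s|z−x|²} − e^{−s|z−u|²} is μ-integrable, and the value F(x,s) = ∫_{ℝ^d} (e^{−s|z−x|²} − e^{−s|z−u|²}) dμ(z) is independent of the choice of u ∈ Σ; moreover Σ = ⋂_{s>0} { x ∈ ℝ^d : F(x,s) = 0 }. -/

import Mathlib

open MeasureTheory Metric Filter Set

noncomputable section

abbrev Euc (d : ℕ) : Type := EuclideanSpace ℝ (Fin d)

/-- The support of a measure: points all of whose closed balls have positive measure. -/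
def msupport {d : ℕ} (μ : Measure (Euc d)) : Set (Euc d) :=
  {x | ∀ r : ℝ, 0 < r → 0 < μ (Metric.closedBall x r)}

/-- `φ` is a distribution function of the uniformly distributed measure `μ`. -/
def IsDistributionFunction {d : ℕ} (μ : Measure (Euc d)) (φ : ℝ → ENNReal) : Prop :=
  (msupport μ).Nonempty ∧
  (∀ r : ℝ, 0 < r → 0 < φ r ∧ φ r < ⊤) ∧
  (∀ x ∈ msupport μ, ∀ r : ℝ, 0 < r → μ (Metric.closedBall x r) = φ r)

/-- `μ` is uniformly distributed. -/
def UniformlyDistributed {d : ℕ} (μ : Measure (Euc d)) : Prop :=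
  ∃ φ : ℝ → ENNReal, IsDistributionFunction μ φ

/-- `dim₀ μ = n` : the limit of `φ(r)/rⁿ` as `r → 0⁺` exists, is finite and positive. -/
def HasDim0 (φ : ℝ → ENNReal) (n : ℕ) : Prop :=
  ∃ c : ℝ, 0 < c ∧
    Filter.Tendsto (fun r : ℝ => (φ r).toReal / r ^ n) (nhdsWithin 0 (Set.Ioi 0)) (nhds c)

/-- `dim_∞ μ = p` : the limit of `φ(r)/r^p` as `r → ∞` exists, is finite and positive. -/
def HasDimInfty (φ : ℝ → ENNReal) (p : ℕ) : Prop :=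
  ∃ c : ℝ, 0 < c ∧
    Filter.Tendsto (fun r : ℝ => (φ r).toReal / r ^ p) Filter.atTop (nhds c)

/-- The affine `n`-planes of `ℝ^d`. -/
def nPlanes (d n : ℕ) : Set (AffineSubspace ℝ (Euc d)) :=
  {L | (L : Set (Euc d)).Nonempty ∧ Module.finrank ℝ L.direction = n}

/-- Jones' beta number `β^n_μ(B(x,r))`. -/
def jonesBeta {d : ℕ} (n : ℕ) (μ : Measure (Euc d)) (x : Euc d) (r : ℝ) : ℝ :=
  ⨅ L : nPlanes d n,
    ⨆ y : (msupport μ ∩ Metric.closedBall x r : Set (Euc d)),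
      Metric.infDist y.1 (L.1 : Set (Euc d)) / r

/-- The bilateral beta number `bβ^n_μ(B(x,r))`. -/
def bilateralBeta {d : ℕ} (n : ℕ) (μ : Measure (Euc d)) (x : Euc d) (r : ℝ) : ℝ :=
  ⨅ L : nPlanes d n,
    ((⨆ y : (msupport μ ∩ Metric.closedBall x r : Set (Euc d)),
        Metric.infDist y.1 (L.1 : Set (Euc d)) / r) +
     (⨆ p : ((L.1 : Set (Euc d)) ∩ Metric.closedBall x r : Set (Euc d)),
        Metric.infDist p.1 (msupport μ) / r))

/-- `μ` is doubling with constant `C`. -/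
def DoublingWith {d : ℕ} (μ : Measure (Euc d)) (C : ℝ) : Prop :=
  ∀ x ∈ msupport μ, ∀ r : ℝ, 0 < r →
    μ (Metric.closedBall x (2 * r)) ≤ ENNReal.ofReal C * μ (Metric.closedBall x r)

/-- `μ` is doubling. -/
def Doubling {d : ℕ} (μ : Measure (Euc d)) : Prop :=
  ∃ C : ℝ, 0 < C ∧ DoublingWith μ C

/-- Weak convergence of a sequence of Radon measures. -/
def WeakConv {d : ℕ} (μs : ℕ → Measure (Euc d)) (μ : Measure (Euc d)) : Prop :=
  ∀ f : Euc d → ℝ, Continuous f → HasCompactSupport f →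
    Filter.Tendsto (fun j => ∫ x, f x ∂(μs j)) Filter.atTop (nhds (∫ x, f x ∂μ))

/-- `μ` is `n`-asymptotically optimally doubling. -/
def AsympOptDoubling {d : ℕ} (n : ℕ) (μ : Measure (Euc d)) : Prop :=
  ∀ K : Set (Euc d), IsCompact K → K ⊆ msupport μ →
    ∀ t : ℝ, t ∈ Set.Icc (1/2 : ℝ) 1 →
      Filter.Tendsto
        (fun r : ℝ => ⨆ x : K,
          |(μ (Metric.closedBall x.1 (t * r)) / μ (Metric.closedBall x.1 r)).toReal - t ^ n|)
        (nhdsWithin 0 (Set.Ioi 0)) (nhds 0)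

/-- Truncated `n`-Riesz transform `R_{r,s}μ(z)`. -/
def rieszT {d : ℕ} (n : ℕ) (μ : Measure (Euc d)) (z : Euc d) (r s : ℝ) : Euc d :=
  ∫ y in {y : Euc d | r ≤ dist y z ∧ dist y z ≤ s}, (‖y - z‖ ^ (n + 1))⁻¹ • (y - z) ∂μ

/-- `μ` is locally Ahlfors `n`-regular. -/
def LocallyAhlforsRegular {d : ℕ} (n : ℕ) (μ : Measure (Euc d)) : Prop :=
  ∀ K : Set (Euc d), IsCompact K → ∃ c : ℝ, 0 < c ∧ ∃ rK : ℝ, 0 < rK ∧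
    ∀ x ∈ msupport μ ∩ K, ∀ r : ℝ, 0 < r → r ≤ rK →
      ENNReal.ofReal (c⁻¹ * r ^ n) ≤ μ (Metric.closedBall x r) ∧
      μ (Metric.closedBall x r) ≤ ENNReal.ofReal (c * r ^ n)

/-- `μ` is locally uniformly `n`-rectifiable. -/
def LocUnifRectifiable {d : ℕ} (n : ℕ) (μ : Measure (Euc d)) : Prop :=
  LocallyAhlforsRegular n μ ∧
  ∀ K : Set (Euc d), IsCompact K →
    ∃ RK θK MK : ℝ, 0 < RK ∧ 0 < θK ∧ 0 < MK ∧
      ∀ x ∈ msupport μ ∩ K, ∀ R : ℝ, 0 < R → R ≤ RK →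
        ∃ g : EuclideanSpace ℝ (Fin n) → Euc d,
          LipschitzWith (Real.toNNReal MK) g ∧
          ENNReal.ofReal (θK * R ^ n) ≤ μ (Metric.closedBall x R ∩ Set.range g)

theorem msupport_eq_support {d : ℕ} (μ : Measure (Euc d)) : msupport μ = μ.support := by
  ext x
  exact (Metric.nhds_basis_closedBall.mem_measureSupport (μ := μ)).symm

theorem integrable_exp_neg_mul_sq_norm_sub_volume {d : ℕ} (x : Euc d) {s : ℝ} (hs : 0 < s) :
    Integrable (fun z : Euc d => Real.exp (-s * ‖z - x‖ ^ 2)) volume := by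
  have h := (GaussianFourier.integrable_cexp_neg_mul_sq_norm_add (V := Euc d)
    (b := (s : ℂ)) (by simpa using hs) 0 0).norm
  have h' : Integrable (fun z : Euc d => Real.exp (-s * ‖z‖ ^ 2)) volume := by
    refine h.congr (.of_forall fun z => ?_)
    simp only [Complex.norm_exp]
    norm_cast
    simp
  exact h'.comp_sub_right x

/-- A uniform bound on the measure of balls of radius `1 / 2` makes all Gaussians integrable. -/
theorem integrable_exp_neg_mul_sq_norm_sub {d : ℕ} (μ : Measure (Euc d)) [SFinite μ]
    {C : ENNReal} (hC : C ≠ ⊤) (hμ : ∀ y, μ (closedBall y (1 / 2)) ≤ C)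
    (x : Euc d) {s : ℝ} (hs : 0 < s) :
    Integrable (fun z => Real.exp (-s * ‖z - x‖ ^ 2)) μ := by
  refine ⟨by fun_prop, ?_⟩
  rw [hasFiniteIntegral_iff_ofReal (.of_forall fun z => (Real.exp_pos _).le)]
  set V : ENNReal := volume (closedBall (0 : Euc d) (1 / 2)) with hV
  have hV0 : V ≠ 0 := (measure_closedBall_pos volume _ (by norm_num)).ne'
  set g : Euc d → ENNReal :=
    fun y => ENNReal.ofReal (Real.exp (s / 4 + -(s / 2) * ‖y - x‖ ^ 2))
  have hgm : Measurable g := by fun_prop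
  have hgfin : ∫⁻ y, g y ∂volume < ⊤ := by
    have h := (integrable_exp_neg_mul_sq_norm_sub_volume x (half_pos hs)).const_mul
      (Real.exp (s / 4))
    simp_rw [← Real.exp_add] at h
    have := h.2
    rwa [hasFiniteIntegral_iff_ofReal (.of_forall fun z => (Real.exp_pos _).le)] at this
  let f : Euc d → Euc d → ENNReal := fun z y => (closedBall z (1 / 2)).indicator g y
  have hfm : Measurable (Function.uncurry f) := by
    have : Function.uncurry f =
        {p : Euc d × Euc d | dist p.2 p.1 ≤ 1 / 2}.indicator (fun p => g p.2) := by
      ext p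
      simp [f, Function.uncurry, Set.indicator]
    rw [this]
    exact (hgm.comp measurable_snd).indicator
      (isClosed_le (by fun_prop) continuous_const).measurableSet
  have hpt : ∀ z, ENNReal.ofReal (Real.exp (-s * ‖z - x‖ ^ 2)) * V ≤ ∫⁻ y, f z y ∂volume := by
    intro z
    have hVz : V = volume (closedBall z (1 / 2)) := by
      rw [hV, Measure.addHaar_closedBall_center volume z]
    rw [lintegral_indicator measurableSet_closedBall, hVz, ← setLIntegral_const]
    refine setLIntegral_mono hgm fun y hy => ENNReal.ofReal_le_ofReal (Real.exp_le_exp.2 ?_)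
    have h1 : ‖y - z‖ ≤ 1 / 2 := by simpa [dist_eq_norm] using hy
    have h2 : ‖y - x‖ ≤ ‖y - z‖ + ‖z - x‖ := norm_sub_le_norm_sub_add_norm_sub y z x
    have h3 : ‖y - x‖ ^ 2 ≤ 1 / 2 + 2 * ‖z - x‖ ^ 2 := by
      have := norm_nonneg (y - x)
      nlinarith [sq_nonneg (1 / 2 - ‖z - x‖), norm_nonneg (z - x)]
    nlinarith
  have hle : (∫⁻ z, ENNReal.ofReal (Real.exp (-s * ‖z - x‖ ^ 2)) ∂μ) * V
      ≤ (∫⁻ y, g y ∂volume) * C := by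
    rw [← lintegral_mul_const _ (by fun_prop), ← lintegral_mul_const _ hgm]
    refine (lintegral_mono hpt).trans ?_
    rw [lintegral_lintegral_swap hfm.aemeasurable]
    refine lintegral_mono fun y => ?_
    have : (fun z => f z y) = (closedBall y (1 / 2)).indicator fun _ => g y := by
      ext z
      simp [f, Set.indicator, dist_comm]
    simp only [this, lintegral_indicator measurableSet_closedBall, setLIntegral_const]
    gcongr
    exact hμ y
  by_contra htop
  rw [not_lt, top_le_iff] at htop
  rw [htop, ENNReal.top_mul hV0, top_le_iff] at hle
  exact ENNReal.mul_ne_top hgfin.ne hC hle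

theorem IsDistributionFunction.measure_closedBall_half_le {d : ℕ} {μ : Measure (Euc d)}
    {φ : ℝ → ENNReal} (hφ : IsDistributionFunction μ φ) (y : Euc d) :
    μ (closedBall y (1 / 2)) ≤ φ 1 := by
  rcases eq_zero_or_pos (μ (closedBall y (1 / 2))) with h | h
  · rw [h]
    exact zero_le
  · obtain ⟨z, hzy, hz⟩ := Measure.nonempty_inter_support_of_pos h
    rw [← msupport_eq_support] at hz
    rw [← hφ.2.2 z hz 1 one_pos]
    refine measure_mono (closedBall_subset_closedBall' ?_)
    rw [dist_comm]
    linarith [mem_closedBall.1 hzy]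

theorem setOf_le_exp_neg_mul_sq_norm_sub {d : ℕ} (x : Euc d) {s t : ℝ} (hs : 0 < s)
    (ht : 0 < t) (ht1 : t < 1) :
    {z : Euc d | t ≤ Real.exp (-s * ‖z - x‖ ^ 2)} = closedBall x √(-Real.log t / s) := by
  ext z
  rw [mem_closedBall, dist_eq_norm, Real.le_sqrt (norm_nonneg _), le_div_iff₀ hs,
    mem_ofPred_eq, ← Real.log_le_iff_le_exp ht]
  · constructor <;> intro h <;> linarith
  · exact div_nonneg (neg_nonneg.2 (Real.log_nonpos ht.le ht1.le)) hs.le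

theorem IsDistributionFunction.integral_exp_eq {d : ℕ} {μ : Measure (Euc d)}
    {φ : ℝ → ENNReal} (hφ : IsDistributionFunction μ φ) {u v : Euc d} (hu : u ∈ msupport μ)
    (hv : v ∈ msupport μ) {s : ℝ} (hs : 0 < s) :
    ∫ z, Real.exp (-s * ‖z - u‖ ^ 2) ∂μ = ∫ z, Real.exp (-s * ‖z - v‖ ^ 2) ∂μ := by
  have hnn : ∀ x : Euc d, 0 ≤ᵐ[μ] fun z => Real.exp (-s * ‖z - x‖ ^ 2) :=
    fun x => .of_forall fun z => (Real.exp_pos _).le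
  rw [integral_eq_lintegral_of_nonneg_ae (hnn u) (by fun_prop),
    integral_eq_lintegral_of_nonneg_ae (hnn v) (by fun_prop),
    lintegral_eq_lintegral_meas_le μ (hnn u) (by fun_prop),
    lintegral_eq_lintegral_meas_le μ (hnn v) (by fun_prop)]
  congr 1
  refine lintegral_congr_ae ?_
  filter_upwards [ae_restrict_mem measurableSet_Ioi,
    ae_restrict_of_ae (measure_eq_zero_iff_ae_notMem.1 (Real.volume_singleton (a := 1)))]
    with t ht ht1
  rcases lt_or_gt_of_ne (show t ≠ 1 from ht1) with h | h
  · have hr : 0 < √(-Real.log t / s) :=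
      Real.sqrt_pos.2 (div_pos (neg_pos.2 (Real.log_neg ht h)) hs)
    rw [setOf_le_exp_neg_mul_sq_norm_sub u hs ht h, setOf_le_exp_neg_mul_sq_norm_sub v hs ht h,
      hφ.2.2 u hu _ hr, hφ.2.2 v hv _ hr]
  · have hempty : ∀ x : Euc d, {z : Euc d | t ≤ Real.exp (-s * ‖z - x‖ ^ 2)} = ∅ := by
      refine fun x => eq_empty_of_forall_notMem fun z hz => ?_
      have : Real.exp (-s * ‖z - x‖ ^ 2) ≤ 1 :=
        Real.exp_le_one_iff.2 (by nlinarith [sq_nonneg ‖z - x‖])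
      exact absurd (h.trans_le (le_trans hz this)) (lt_irrefl _)
    rw [hempty u, hempty v]

/-- The Gaussian integrals separate points of the support from the other points. -/
theorem mem_msupport_of_integral_exp_eq {d : ℕ} {μ : Measure (Euc d)} [IsLocallyFiniteMeasure μ]
    (hint : ∀ (y : Euc d) (s : ℝ), 0 < s →
      Integrable (fun z => Real.exp (-s * ‖z - y‖ ^ 2)) μ)
    {u x : Euc d} (hu : u ∈ msupport μ)
    (h : ∀ s : ℝ, 0 < s →
      ∫ z, Real.exp (-s * ‖z - x‖ ^ 2) ∂μ = ∫ z, Real.exp (-s * ‖z - u‖ ^ 2) ∂μ) :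
    x ∈ msupport μ := by
  by_contra hx
  simp only [msupport, mem_ofPred_eq, not_forall, not_lt, nonpos_iff_eq_zero] at hx
  obtain ⟨ε, hε, hxε⟩ := hx
  set A : ℝ := ∫ z, Real.exp (-1 * ‖z - x‖ ^ 2) ∂μ
  set m : ℝ := μ.real (closedBall u (ε / 2))
  have hm : 0 < m := ENNReal.toReal_pos (hu _ (half_pos hε)).ne' measure_closedBall_lt_top.ne
  have hupper : ∀ s : ℝ, 1 ≤ s →
      ∫ z, Real.exp (-s * ‖z - x‖ ^ 2) ∂μ ≤ Real.exp (-(s - 1) * ε ^ 2) * A := by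
    intro s hs
    rw [← integral_const_mul]
    refine integral_mono_ae (hint x s (by linarith)) ((hint x 1 one_pos).const_mul _) ?_
    filter_upwards [measure_eq_zero_iff_ae_notMem.1 hxε] with z hz
    rw [← Real.exp_add, Real.exp_le_exp]
    have h1 : ε < ‖z - x‖ := by simpa [dist_eq_norm] using hz
    nlinarith [mul_nonneg (sub_nonneg.2 hs) (sub_nonneg.2 (pow_le_pow_left₀ hε.le h1.le 2))]
  have hlower : ∀ s : ℝ, 0 < s →
      m * Real.exp (-s * (ε / 2) ^ 2) ≤ ∫ z, Real.exp (-s * ‖z - u‖ ^ 2) ∂μ := by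
    intro s hs
    refine le_trans ?_ (setIntegral_le_integral (s := closedBall u (ε / 2)) (hint u s hs)
      (.of_forall fun z => (Real.exp_pos _).le))
    rw [← smul_eq_mul, ← setIntegral_const]
    refine setIntegral_mono_on (integrableOn_const measure_closedBall_lt_top.ne)
      (hint u s hs).integrableOn measurableSet_closedBall fun z hz => Real.exp_le_exp.2 ?_
    have h1 : ‖z - u‖ ≤ ε / 2 := by simpa [dist_eq_norm] using hz
    nlinarith [pow_le_pow_left₀ (norm_nonneg _) h1 2]
  have hbound : ∀ s : ℝ, 1 ≤ s → m ≤ Real.exp (ε ^ 2) * A * Real.exp (-(s * (3 / 4 * ε ^ 2))) := by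
    intro s hs
    have h1 := ((hlower s (by linarith)).trans_eq (h s (by linarith)).symm).trans (hupper s hs)
    refine le_of_mul_le_mul_right (h1.trans_eq ?_) (Real.exp_pos (-s * (ε / 2) ^ 2))
    rw [mul_assoc, ← Real.exp_add, mul_right_comm, ← Real.exp_add]
    ring_nf
  have hlim : Tendsto (fun s : ℝ => Real.exp (ε ^ 2) * A * Real.exp (-(s * (3 / 4 * ε ^ 2))))
      atTop (nhds (Real.exp (ε ^ 2) * A * 0)) :=
    (Real.tendsto_exp_neg_atTop_nhds_zero.comp
      (tendsto_id.atTop_mul_const (by positivity))).const_mul _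
  rw [mul_zero] at hlim
  exact hm.not_ge (ge_of_tendsto hlim ((eventually_ge_atTop 1).mono hbound))

theorem support_is_analytic_variety {d : ℕ}
    (μ : Measure (Euc d)) [IsLocallyFiniteMeasure μ]
    (hμ : UniformlyDistributed μ) (u : Euc d) (hu : u ∈ msupport μ) :
    (∀ (x : Euc d) (s : ℝ), 0 < s →
      MeasureTheory.Integrable
        (fun z => Real.exp (-s * ‖z - x‖ ^ 2) - Real.exp (-s * ‖z - u‖ ^ 2)) μ) ∧
    (∀ (x : Euc d) (s : ℝ), 0 < s → ∀ u' ∈ msupport μ,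
      ∫ z, (Real.exp (-s * ‖z - x‖ ^ 2) - Real.exp (-s * ‖z - u‖ ^ 2)) ∂μ =
      ∫ z, (Real.exp (-s * ‖z - x‖ ^ 2) - Real.exp (-s * ‖z - u'‖ ^ 2)) ∂μ) ∧
    msupport μ = ⋂ s ∈ Set.Ioi (0:ℝ),
      {x : Euc d |
        ∫ z, (Real.exp (-s * ‖z - x‖ ^ 2) - Real.exp (-s * ‖z - u‖ ^ 2)) ∂μ = 0} := by
  obtain ⟨φ, hφ⟩ := hμ
  have hint : ∀ (y : Euc d) (s : ℝ), 0 < s →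
      Integrable (fun z => Real.exp (-s * ‖z - y‖ ^ 2)) μ := fun y s hs =>
    integrable_exp_neg_mul_sq_norm_sub μ (hφ.2.1 1 one_pos).2.ne hφ.measure_closedBall_half_le y hs
  refine ⟨fun x s hs => (hint x s hs).sub (hint u s hs), fun x s hs u' hu' => ?_, ?_⟩
  · rw [integral_sub (hint x s hs) (hint u s hs), integral_sub (hint x s hs) (hint u' s hs),
      hφ.integral_exp_eq hu hu' hs]
  · ext x
    simp only [mem_iInter, mem_Ioi, mem_ofPred_eq]
    constructor
    · intro hx s hs
      rw [integral_sub (hint x s hs) (hint u s hs), hφ.integral_exp_eq hx hu hs, sub_self]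
    · intro h
      refine mem_msupport_of_integral_exp_eq hint hu fun s hs => ?_
      rw [← sub_eq_zero, ← integral_sub (hint x s hs) (hint u s hs)]
      exact h s hs
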